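/- arXiv:1907.09445 — 5 statements merged into one kernel-verified Lean document; each statement's English description precedes it below -/
import Mathlib

section
/- Let n1, n2 be positive integers and let t > 0 be a real number. Then the following are equivalent: (i) for all natural numbers k1, k2 with k1 + k2 > 0 and k1 + k2 even, one has k1*(k1 + n1 - 1)*(1 + t^2) + k2*(k2 + n2 - 1)*(1 + t^{-2}) ≥ (n1 + n2) + n1*t^2 + n2*t^{-2}; (ii) n2/(n1+2) ≤ t^2 ≤ (n2+2)/n1. -/
/-- On `S^n`, the Laplace eigenvalues `k * (k + n - 1)` are monotone in the degree `k`. -/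
theorem sphere_eigenvalue_mono {n j k : ℕ} (hn : 0 < n) (hjk : j ≤ k) :
    (j : ℝ) * ((j : ℝ) + (n : ℝ) - 1) ≤ (k : ℝ) * ((k : ℝ) + (n : ℝ) - 1) := by
  have hn' : (1 : ℝ) ≤ n := by exact_mod_cast hn
  have hjk' : (j : ℝ) ≤ k := by exact_mod_cast hjk
  have hj : (0 : ℝ) ≤ j := j.cast_nonneg
  exact mul_le_mul hjk' (by linarith) (by linarith) (by linarith)

/-- Stability criterion for the Clifford hypersurface
`S^{n1}(cos r) × S^{n2}(sin r)` projected to `RP^{n+1}`, with `t = tan r`: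
the eigenvalue inequality for all antipodal-invariant modes (`k1 + k2` even,
positive) is equivalent to `n2/(n1+2) ≤ t^2 ≤ (n2+2)/n1`. -/
theorem clifford_stability_criterion (n1 n2 : ℕ) (hn1 : 0 < n1) (hn2 : 0 < n2)
    (t : ℝ) (ht : 0 < t) :
    (∀ k1 k2 : ℕ, 0 < k1 + k2 → Even (k1 + k2) →
      (k1 : ℝ) * ((k1 : ℝ) + (n1 : ℝ) - 1) * (1 + t ^ 2)
        + (k2 : ℝ) * ((k2 : ℝ) + (n2 : ℝ) - 1) * (1 + 1 / t ^ 2)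
      ≥ ((n1 : ℝ) + (n2 : ℝ)) + (n1 : ℝ) * t ^ 2 + (n2 : ℝ) * (1 / t ^ 2))
    ↔ ((n2 : ℝ) / ((n1 : ℝ) + 2) ≤ t ^ 2 ∧ t ^ 2 ≤ ((n2 : ℝ) + 2) / (n1 : ℝ)) := by
  have hs : 0 < t ^ 2 := by positivity
  have hn1' : (0 : ℝ) < n1 := by exact_mod_cast hn1
  have hn2' : (0 : ℝ) < n2 := by exact_mod_cast hn2
  have hb : 0 < 1 + 1 / t ^ 2 := by positivity
  have hab : 1 + t ^ 2 = t ^ 2 * (1 + 1 / t ^ 2) := by field_simp; ring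
  have ha : 0 < 1 + t ^ 2 := by positivity
  rw [div_le_iff₀ (by positivity), le_div_iff₀ hn1']
  have lower : (n2 : ℝ) ≤ t ^ 2 * (n1 + 2) ↔
      (n2 : ℝ) * (1 + 1 / t ^ 2) ≤ (n1 + 2) * (1 + t ^ 2) := by
    rw [hab, ← mul_le_mul_iff_left₀ hb]
    ring_nf
  have upper : t ^ 2 * (n1 : ℝ) ≤ n2 + 2 ↔
      (n1 : ℝ) * (1 + t ^ 2) ≤ (n2 + 2) * (1 + 1 / t ^ 2) := by
    rw [hab, ← mul_le_mul_iff_left₀ hb]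
    ring_nf
  rw [lower, upper]
  constructor
  · intro h
    have h20 := h 2 0 (by norm_num) (by decide)
    have h02 := h 0 2 (by norm_num) (by decide)
    push_cast at h20 h02
    constructor <;> linarith
  · rintro ⟨hl, hu⟩ k1 k2 hpos heven
    rcases Nat.eq_zero_or_pos k1 with rfl | hk1
    · have hk2 : 2 ≤ k2 := by grind
      have := mul_le_mul_of_nonneg_right (sphere_eigenvalue_mono hn2 hk2) hb.le
      push_cast at this ⊢
      linarith
    rcases Nat.eq_zero_or_pos k2 with rfl | hk2
    · have hk1 : 2 ≤ k1 := by grind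
      have := mul_le_mul_of_nonneg_right (sphere_eigenvalue_mono hn1 hk1) ha.le
      push_cast at this ⊢
      linarith
    · have h1 := mul_le_mul_of_nonneg_right (sphere_eigenvalue_mono hn1 hk1) ha.le
      have h2 := mul_le_mul_of_nonneg_right (sphere_eigenvalue_mono hn2 hk2) hb.le
      push_cast at h1 h2
      linarith
end

section
/- For every real number x > 0, the series ∑_{l=0}^{∞} 1/(x + 1/2 + l)^2 converges and satisfies ∑_{l=0}^{∞} 1/(x + 1/2 + l)^2 < 1/x. -/
open Filter Topology in
/-- The reciprocals of `x, x + 1, x + 2, …` have telescoping differences summing to `1 / x`. -/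
lemma hasSum_one_div_sub_one_div_add_one {x : ℝ} (hx : 0 < x) :
    HasSum (fun l : ℕ => 1 / (x + l) - 1 / (x + l + 1)) (1 / x) := by
  have hnonneg (l : ℕ) : 0 ≤ 1 / (x + l) - 1 / (x + l + 1) :=
    sub_nonneg.2 (one_div_le_one_div_of_le (by positivity) (by linarith))
  rw [hasSum_iff_tendsto_nat_of_nonneg hnonneg]
  have hsum (n : ℕ) :
      ∑ l ∈ Finset.range n, (1 / (x + l) - 1 / (x + l + 1)) = 1 / x - 1 / (x + n) := by
    induction n with
    | zero => simp
    | succ n ih => rw [Finset.sum_range_succ, ih]; push_cast; ring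
  have hlim : Tendsto (fun n : ℕ => 1 / (x + n)) atTop (𝓝 0) :=
    (tendsto_atTop_add_const_left _ x tendsto_natCast_atTop_atTop).const_div_atTop 1
  simp_rw [hsum]
  simpa only [sub_zero] using hlim.const_sub (1 / x)

lemma one_div_add_half_sq_lt {y : ℝ} (hy : 0 < y) :
    1 / (y + 1 / 2) ^ 2 < 1 / y - 1 / (y + 1) := by
  have h : 1 / y - 1 / (y + 1) = 1 / (y * (y + 1)) := by field_simp; ring
  rw [h]
  exact one_div_lt_one_div_of_lt (by positivity) (by nlinarith)

/-- For `x > 0`, the series `∑_{l=0}^∞ 1/(x + 1/2 + l)²` converges and its sum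
is strictly less than `1/x`. -/
theorem trigamma_type_series_bound (x : ℝ) (hx : 0 < x) :
    Summable (fun l : ℕ => 1 / (x + 1 / 2 + l) ^ 2) ∧
    ∑' l : ℕ, 1 / (x + 1 / 2 + l) ^ 2 < 1 / x := by
  have hlt (l : ℕ) : 1 / (x + 1 / 2 + l) ^ 2 < 1 / (x + l) - 1 / (x + l + 1) := by
    rw [add_right_comm x]
    exact one_div_add_half_sq_lt (by positivity)
  have hsum := hasSum_one_div_sub_one_div_add_one hx
  have hnonneg (l : ℕ) : 0 ≤ 1 / (x + 1 / 2 + l) ^ 2 := by positivity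
  refine ⟨.of_nonneg_of_le hnonneg (fun l => (hlt l).le) hsum.summable, ?_⟩
  rw [← hsum.tsum_eq]
  exact Summable.tsum_lt_tsum_of_nonneg hnonneg (fun l => (hlt l).le) (hlt 0) hsum.summable
end

section
/- Let n ≥ 2 be an integer. Define f̄ : (0,n) → ℝ by f̄(x) = 2·ln 2 + ((n+2)/2)·ln π + (x/2)·ln(x/n) + ((n−x)/2)·ln((n−x)/n) − ln Γ((x+1)/2) − ln Γ((n−x+1)/2), where Γ is the real Gamma function. Then f̄ has positive second derivative on (0,n); in particular f̄ is strictly convex on the interval (0,n). -/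
open Filter Topology in
theorem hasSum_sub_of_tendsto_zero {f : ℕ → ℝ} (hf : Antitone f)
    (hlim : Tendsto f atTop (𝓝 0)) : HasSum (fun m => f m - f (m + 1)) (f 0) := by
  rw [hasSum_iff_tendsto_nat_of_nonneg fun m => sub_nonneg.2 (hf m.le_succ)]
  simp_rw [Finset.sum_range_sub']
  simpa using hlim.const_sub (f 0)

theorem summable_one_div_nat_add_one_sq : Summable fun m : ℕ => 1 / ((m : ℝ) + 1) ^ 2 := by
  have h := (summable_nat_add_iff 1).2 (Real.summable_one_div_nat_pow.2 one_lt_two)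
  exact_mod_cast h

namespace Real

/-- The terms of a series for `log (Gamma x) + log x`, normalized to vanish at `x = 1`. -/
noncomputable def logGammaTerm (m : ℕ) (x : ℝ) : ℝ :=
  x * (log (m + 2) - log (m + 1)) - log (x + m + 1) + log (m + 1)

/-- The terms of a series for the logarithmic derivative of `Gamma` at `x`, plus `1 / x`. -/
noncomputable def digammaTerm (m : ℕ) (x : ℝ) : ℝ :=
  log (m + 2) - log (m + 1) - 1 / (x + m + 1)

theorem hasDerivAt_logGammaTerm (m : ℕ) {x : ℝ} (hx : 0 < x) :
    HasDerivAt (logGammaTerm m) (digammaTerm m x) x := by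
  have hpos : x + m + 1 ≠ 0 := by positivity
  have h := (((hasDerivAt_id x).mul_const (log (m + 2) - log (m + 1))).sub
    ((((hasDerivAt_id x).add_const (m : ℝ)).add_const 1).log hpos)).add_const (log (m + 1))
  rwa [one_mul] at h

theorem hasDerivAt_digammaTerm (m : ℕ) {x : ℝ} (hx : 0 < x) :
    HasDerivAt (digammaTerm m) (1 / (x + m + 1) ^ 2) x := by
  have hpos : x + m + 1 ≠ 0 := by positivity
  have h := ((((hasDerivAt_id x).add_const (m : ℝ)).add_const 1).inv hpos).const_sub
    (log (m + 2) - log (m + 1))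
  convert! h using 1
  · ext y; simp [digammaTerm]
  · simp [neg_div]

theorem abs_digammaTerm_le (m : ℕ) {x R : ℝ} (hx : 0 < x) (hxR : x < R) (hR : 1 < R) :
    |digammaTerm m x| ≤ R * (1 / ((m : ℝ) + 1) ^ 2) := by
  have hm : (0 : ℝ) < m + 1 := by positivity
  have hlog : log (m + 2) - log (m + 1) = log ((m + 2) / (m + 1) : ℝ) :=
    (log_div (by positivity) (by positivity)).symm
  have hq : (0 : ℝ) < (m + 2) / (m + 1) := by positivity
  have hupper : log ((m + 2) / (m + 1) : ℝ) ≤ 1 / (m + 1) := by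
    convert log_le_sub_one_of_pos hq using 1
    field_simp
    ring
  have hlower : 1 / (m + 1 + R) ≤ log ((m + 2) / (m + 1) : ℝ) := by
    refine le_trans ?_ (one_sub_inv_le_log_of_pos hq)
    have : 1 - ((m + 2) / (m + 1) : ℝ)⁻¹ = 1 / (m + 2) := by
      field_simp
      ring
    rw [this]
    exact one_div_le_one_div_of_le (by positivity) (by linarith)
  have hinv_upper : 1 / (x + m + 1) ≤ 1 / ((m : ℝ) + 1) :=
    one_div_le_one_div_of_le hm (by linarith)
  have hinv_lower : 1 / (m + 1 + R) ≤ 1 / (x + m + 1) :=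
    one_div_le_one_div_of_le (by positivity) (by linarith)
  have hgap : 1 / ((m : ℝ) + 1) - 1 / (m + 1 + R) ≤ R * (1 / ((m : ℝ) + 1) ^ 2) := by
    have hR0 : 0 < R := hx.trans hxR
    rw [div_sub_div _ _ (by positivity) (by positivity), mul_one_div,
      div_le_div_iff₀ (by positivity) (by positivity)]
    nlinarith [mul_pos (mul_pos hR0 hR0) hm]
  rw [digammaTerm, hlog, abs_le]
  constructor <;> linarith

theorem summable_digammaTerm {x : ℝ} (hx : 0 < x) : Summable fun m => digammaTerm m x :=
  .of_norm_bounded (summable_one_div_nat_add_one_sq.mul_left (x + 1)) fun m =>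
    abs_digammaTerm_le m hx (by linarith) (by linarith)

theorem logGammaTerm_one (m : ℕ) : logGammaTerm m 1 = 0 := by
  rw [logGammaTerm, show (1 : ℝ) + m + 1 = m + 2 by ring]
  ring

theorem summable_logGammaTerm {x : ℝ} (hx : 0 < x) : Summable fun m => logGammaTerm m x :=
  summable_of_summable_hasDerivAt_of_isPreconnected (t := Set.Ioo 0 (x + 2)) (y₀ := 1)
    (summable_one_div_nat_add_one_sq.mul_left (x + 2)) isOpen_Ioo isPreconnected_Ioo
    (fun m _ hy => hasDerivAt_logGammaTerm m hy.1)
    (fun m _ hy => abs_digammaTerm_le m hy.1 hy.2 (by linarith))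
    ⟨one_pos, by linarith⟩ (by simp only [logGammaTerm_one, summable_zero])
    ⟨hx, by linarith⟩

theorem hasDerivAt_tsum_logGammaTerm {x : ℝ} (hx : 0 < x) :
    HasDerivAt (fun y => ∑' m, logGammaTerm m y) (∑' m, digammaTerm m x) x :=
  hasDerivAt_tsum_of_isPreconnected (t := Set.Ioo 0 (x + 2)) (y₀ := 1)
    (summable_one_div_nat_add_one_sq.mul_left (x + 2)) isOpen_Ioo isPreconnected_Ioo
    (fun m _ hy => hasDerivAt_logGammaTerm m hy.1)
    (fun m _ hy => abs_digammaTerm_le m hy.1 hy.2 (by linarith))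
    ⟨one_pos, by linarith⟩ (by simp only [logGammaTerm_one, summable_zero])
    ⟨hx, by linarith⟩

theorem hasDerivAt_tsum_digammaTerm {x : ℝ} (hx : 0 < x) :
    HasDerivAt (fun y => ∑' m, digammaTerm m y) (∑' m : ℕ, 1 / (x + m + 1) ^ 2) x := by
  refine hasDerivAt_tsum_of_isPreconnected (t := Set.Ioi 0) (y₀ := x)
    summable_one_div_nat_add_one_sq isOpen_Ioi isPreconnected_Ioi
    (fun m _ hy => hasDerivAt_digammaTerm m hy) (fun m y hy => ?_) hx
    (summable_digammaTerm hx) hx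
  have hy : 0 < y := hy
  rw [norm_of_nonneg (by positivity)]
  gcongr
  linarith

theorem sum_logGammaTerm (x : ℝ) (n : ℕ) :
    ∑ m ∈ Finset.range n, logGammaTerm m x =
      BohrMollerup.logGammaSeq x n + x * (log (n + 1) - log n) + log x := by
  induction n with
  | zero => simp [BohrMollerup.logGammaSeq]
  | succ n ih =>
    rw [Finset.sum_range_succ, ih, BohrMollerup.logGammaSeq, BohrMollerup.logGammaSeq,
      Finset.sum_range_succ _ (n + 1), Nat.factorial_succ, Nat.cast_mul,
      log_mul (by positivity) (by positivity), logGammaTerm]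
    push_cast
    rw [show (n : ℝ) + 1 + 1 = n + 2 by ring, add_assoc x]
    ring

open Filter in
theorem log_Gamma_eq_tsum {x : ℝ} (hx : 0 < x) :
    log (Gamma x) = ∑' m, logGammaTerm m x - log x := by
  have h := ((BohrMollerup.tendsto_log_gamma hx).add
    (tendsto_log_nat_add_one_sub_log.const_mul x)).add_const (log x)
  simp_rw [← sum_logGammaTerm] at h
  rw [tendsto_nhds_unique (summable_logGammaTerm hx).hasSum.tendsto_sum_nat h]
  ring

/-- The logarithmic derivative of `Gamma` on the positive reals, as a series. -/
noncomputable def digammaSeries (x : ℝ) : ℝ := ∑' m, digammaTerm m x - 1 / x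

theorem hasDerivAt_log_Gamma {x : ℝ} (hx : 0 < x) :
    HasDerivAt (fun y => log (Gamma y)) (digammaSeries x) x := by
  have h := (hasDerivAt_tsum_logGammaTerm hx).sub (hasDerivAt_log hx.ne')
  rw [← one_div] at h
  refine h.congr_of_eventuallyEq ?_
  filter_upwards [lt_mem_nhds hx] with y hy using log_Gamma_eq_tsum hy

theorem summable_one_div_add_nat_sq {x : ℝ} (hx : 0 < x) :
    Summable fun l : ℕ => 1 / (x + l) ^ 2 := by
  rw [← summable_nat_add_iff 1]
  refine .of_nonneg_of_le (fun _ => by positivity) (fun m => ?_) summable_one_div_nat_add_one_sq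
  push_cast
  exact one_div_le_one_div_of_le (by positivity)
    (pow_le_pow_left₀ (by positivity) (le_add_of_nonneg_left hx.le) 2)

theorem hasDerivAt_digammaSeries {x : ℝ} (hx : 0 < x) :
    HasDerivAt digammaSeries (∑' l : ℕ, 1 / (x + l) ^ 2) x := by
  have h := (hasDerivAt_tsum_digammaTerm hx).sub (hasDerivAt_inv hx.ne')
  simp_rw [← one_div] at h
  convert! h using 1
  rw [(summable_one_div_add_nat_sq hx).tsum_eq_zero_add]
  push_cast
  simp_rw [add_assoc]
  simp
  ring

open Filter in
theorem tsum_one_div_add_half_sq_lt {x : ℝ} (hx : 0 < x) :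
    ∑' l : ℕ, 1 / (x + 1 / 2 + l) ^ 2 < 1 / x := by
  have hanti : Antitone fun l : ℕ => 1 / (x + l) := by
    intro a b hab
    dsimp only
    gcongr
  have hlim : Tendsto (fun l : ℕ => 1 / (x + l)) atTop (nhds 0) := by
    simp_rw [one_div]
    exact tendsto_inv_atTop_zero.comp (tendsto_atTop_add_const_left _ _ tendsto_natCast_atTop_atTop)
  have htel := hasSum_sub_of_tendsto_zero hanti hlim
  simp only [Nat.cast_zero, add_zero] at htel
  have hlt (l : ℕ) : 1 / (x + 1 / 2 + l) ^ 2 < 1 / (x + l) - 1 / (x + (l + 1 : ℕ)) := by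
    push_cast
    rw [div_sub_div _ _ (by positivity) (by positivity),
      div_lt_div_iff₀ (by positivity) (by positivity)]
    nlinarith
  exact hasSum_lt (fun l => (hlt l).le) (hlt 0)
    (summable_one_div_add_nat_sq (by positivity)).hasSum htel

/-- The contribution of a single sphere factor to the logarithmic area, up to a constant. -/
noncomputable def logSphereFactor (c x : ℝ) : ℝ :=
  x / 2 * log (x / c) - log (Gamma ((x + 1) / 2))

/-- The derivative of `logSphereFactor c`. -/
noncomputable def logSphereFactorDeriv (c x : ℝ) : ℝ :=
  log (x / c) / 2 + 1 / 2 - digammaSeries ((x + 1) / 2) / 2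

theorem hasDerivAt_logSphereFactor {c x : ℝ} (hc : 0 < c) (hx : 0 < x) :
    HasDerivAt (logSphereFactor c) (logSphereFactorDeriv c x) x := by
  have hlog := ((hasDerivAt_id x).div_const c).log (div_pos hx hc).ne'
  have hGamma := (hasDerivAt_log_Gamma (x := (x + 1) / 2) (by positivity)).comp x
    (((hasDerivAt_id x).add_const 1).div_const 2)
  convert! (((hasDerivAt_id x).div_const 2).mul hlog).sub hGamma using 1
  simp only [logSphereFactorDeriv, id]
  field_simp

theorem exists_hasDerivAt_logSphereFactorDeriv_pos {c x : ℝ} (hc : 0 < c) (hx : 0 < x) :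
    ∃ d, 0 < d ∧ HasDerivAt (logSphereFactorDeriv c) d x := by
  have hlog := ((hasDerivAt_id x).div_const c).log (div_pos hx hc).ne'
  have hdigamma := (hasDerivAt_digammaSeries (x := (x + 1) / 2) (by positivity)).comp x
    (((hasDerivAt_id x).add_const 1).div_const 2)
  refine ⟨_, ?_, ((hlog.div_const 2).add_const (1 / 2)).sub (hdigamma.div_const 2)⟩
  have h := tsum_one_div_add_half_sq_lt (half_pos hx)
  rw [show x / 2 + 1 / 2 = (x + 1) / 2 by ring] at h
  have hleft : 1 / c / (id x / c) / 2 = 1 / (x / 2) / 4 := by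
    simp only [id]
    field_simp
    norm_num
  rw [hleft]
  linarith

end Real

/-- The logarithm `f̄` of the Clifford-hypersurface area function has positive
second derivative on `(0,n)`; in particular it is strictly convex there. -/
theorem log_clifford_area_strictly_convex (n : ℕ) (hn : 2 ≤ n) (fbar : ℝ → ℝ)
    (hf : ∀ x ∈ Set.Ioo (0 : ℝ) n, fbar x =
      2 * Real.log 2 + (((n : ℝ) + 2) / 2) * Real.log Real.pi
        + (x / 2) * Real.log (x / n)
        + (((n : ℝ) - x) / 2) * Real.log (((n : ℝ) - x) / n)
        - Real.log (Real.Gamma ((x + 1) / 2))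
        - Real.log (Real.Gamma (((n : ℝ) - x + 1) / 2))) :
    (∀ x ∈ Set.Ioo (0 : ℝ) n, 0 < deriv (deriv fbar) x) ∧
    StrictConvexOn ℝ (Set.Ioo (0 : ℝ) n) fbar := by
  have hc : (0 : ℝ) < n := by exact_mod_cast (by omega : 0 < n)
  have hfbar : ∀ x ∈ Set.Ioo (0 : ℝ) n, HasDerivAt fbar
      (Real.logSphereFactorDeriv n x - Real.logSphereFactorDeriv n (n - x)) x := by
    intro x hx
    have hrefl := (Real.hasDerivAt_logSphereFactor hc (sub_pos.2 hx.2)).comp x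
      ((hasDerivAt_id x).const_sub (n : ℝ))
    have h := ((Real.hasDerivAt_logSphereFactor hc hx.1).add hrefl).const_add
      (2 * Real.log 2 + (((n : ℝ) + 2) / 2) * Real.log Real.pi)
    rw [mul_neg_one, ← sub_eq_add_neg] at h
    refine h.congr_of_eventuallyEq ?_
    filter_upwards [isOpen_Ioo.mem_nhds hx] with y hy
    rw [hf y hy]
    simp only [Pi.add_apply, Function.comp_apply, Real.logSphereFactor]
    ring
  have hpos : ∀ x ∈ Set.Ioo (0 : ℝ) n, 0 < deriv (deriv fbar) x := by
    intro x hx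
    obtain ⟨a, ha, hda⟩ := Real.exists_hasDerivAt_logSphereFactorDeriv_pos hc hx.1
    obtain ⟨b, hb, hdb⟩ := Real.exists_hasDerivAt_logSphereFactorDeriv_pos hc (sub_pos.2 hx.2)
    have h := hda.sub (hdb.comp x ((hasDerivAt_id x).const_sub (n : ℝ)))
    have hderiv : HasDerivAt (deriv fbar) (a - b * -1) x := by
      refine h.congr_of_eventuallyEq ?_
      filter_upwards [isOpen_Ioo.mem_nhds hx] with y hy using (hfbar y hy).deriv
    rw [hderiv.deriv]
    linarith
  exact ⟨hpos, strictConvexOn_of_deriv2_pos' (convex_Ioo _ _)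
    (fun x hx => (hfbar x hx).continuousAt.continuousWithinAt) hpos⟩
end

section
/- Let n ≥ 2 be an integer. Define S(d) = 2π^{(d+1)/2}/Γ((d+1)/2) for real d ≥ 0, and f(x) = S(x)·S(n−x)·(x/n)^{x/2}·((n−x)/n)^{(n−x)/2} for x ∈ (0,n), where powers are real powers and Γ is the real Gamma function. Then f(x) < 2·S(n) for every x ∈ (0,n). In particular, for every integer p with 1 ≤ p ≤ n−1, twice the area of the unit n-sphere strictly exceeds the area of the minimal Clifford hypersurface S^{p}(√(p/n)) × S^{n−p}(√((n−p)/n)) ⊂ S^{n+1}. -/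
open Real Set Filter Topology

/-- The difference between one step of `t ↦ t log t` and the logarithm at the midpoint of the
step. -/
noncomputable def mulLogStep (s : ℝ) : ℝ := (s + 1) * log (s + 1) - s * log s - log (s + 1 / 2)

lemma hasDerivAt_mulLogStep {s : ℝ} (hs : 0 < s) :
    HasDerivAt mulLogStep (log (s + 1) - log s - (s + 1 / 2)⁻¹) s := by
  have h₁ : HasDerivAt (fun t : ℝ => (t + 1) * log (t + 1)) (log (s + 1) + 1) s :=
    (hasDerivAt_mul_log (by positivity : s + 1 ≠ 0)).comp_add_const s 1
  have h₂ : HasDerivAt (fun t : ℝ => log (t + 1 / 2)) (s + 1 / 2)⁻¹ s :=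
    (hasDerivAt_log (by positivity : s + 1 / 2 ≠ 0)).comp_add_const s (1 / 2)
  exact ((h₁.sub (hasDerivAt_mul_log hs.ne')).sub h₂).congr_deriv (by ring)

lemma continuousOn_mulLogStep : ContinuousOn mulLogStep (Ici 0) := by
  have h : Continuous fun t : ℝ => (t + 1) * log (t + 1) :=
    continuous_mul_log.comp (continuous_id.add continuous_const)
  refine (h.sub continuous_mul_log).continuousOn.sub (ContinuousOn.log (by fun_prop) ?_)
  intro s hs
  have : (0 : ℝ) ≤ s := hs
  positivity

lemma strictConcaveOn_mulLogStep : StrictConcaveOn ℝ (Ici 0) mulLogStep := by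
  refine strictConcaveOn_of_deriv2_neg (convex_Ici 0) continuousOn_mulLogStep fun s hs => ?_
  rw [interior_Ici, mem_Ioi] at hs
  have hderiv : deriv mulLogStep =ᶠ[𝓝 s] fun t => log (t + 1) - log t - (t + 1 / 2)⁻¹ := by
    filter_upwards [Ioi_mem_nhds hs] with t ht
    exact (hasDerivAt_mulLogStep ht).deriv
  have h₁ : HasDerivAt (fun t : ℝ => log (t + 1)) (s + 1)⁻¹ s :=
    (hasDerivAt_log (by positivity : s + 1 ≠ 0)).comp_add_const s 1
  have h₂ : HasDerivAt (fun t : ℝ => (t + 1 / 2)⁻¹) (-((s + 1 / 2) ^ 2)⁻¹) s :=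
    (hasDerivAt_inv (by positivity : s + 1 / 2 ≠ 0)).comp_add_const s (1 / 2)
  have h := ((h₁.sub (hasDerivAt_log hs.ne')).sub h₂).congr_of_eventuallyEq hderiv
  rw [Function.iterate_succ_apply, Function.iterate_one, h.deriv]
  have hprod : s⁻¹ - (s + 1)⁻¹ = (s * (s + 1))⁻¹ := by
    field_simp
    ring
  have hlt : ((s + 1 / 2) ^ 2)⁻¹ < (s * (s + 1))⁻¹ :=
    inv_strictAnti₀ (by positivity) (by linarith [sq_nonneg s])
  linarith

lemma concaveOn_mulLogStep_add {c : ℝ} (hc : 0 ≤ c) :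
    ConcaveOn ℝ (Ici 0) fun u => mulLogStep (u + c) :=
  (strictConcaveOn_mulLogStep.concaveOn.translate_left c).subset
    (fun u (hu : 0 ≤ u) => mem_preimage.2 (mem_Ici.2 (by positivity))) (convex_Ici 0)

lemma concaveOn_of_tendsto {E ι : Type*} [AddCommGroup E] [Module ℝ E] {l : Filter ι} [l.NeBot]
    {s : Set E} {F : ι → E → ℝ} {f : E → ℝ} (hF : ∀ i, ConcaveOn ℝ s (F i))
    (hs : Convex ℝ s) (hlim : ∀ x ∈ s, Tendsto (fun i => F i x) l (𝓝 (f x))) :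
    ConcaveOn ℝ s f :=
  ⟨hs, fun x hx y hy _ _ ha hb hab => le_of_tendsto_of_tendsto'
    (((hlim x hx).const_smul _).add ((hlim y hy).const_smul _))
    (hlim _ (hs hx hy ha hb hab)) fun i => (hF i).2 hx hy ha hb hab⟩

lemma logGammaSeq_add_half_sub_mul_log (u : ℝ) (n : ℕ) :
    BohrMollerup.logGammaSeq (u + 1 / 2) n - u * log u - mulLogStep u =
      (∑ m ∈ Finset.range n, mulLogStep (u + (m + 1)))
        + (-((u + (n + 1)) * log (u + (n + 1)))
          + (u * log n + (1 / 2 * log n + log n.factorial))) := by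
  have key : ∀ k : ℕ, ∑ m ∈ Finset.range k, mulLogStep (u + m) =
      (u + k) * log (u + k) - u * log u - ∑ m ∈ Finset.range k, log (u + 1 / 2 + m) := by
    intro k
    induction k with
    | zero => simp
    | succ k ih =>
      rw [Finset.sum_range_succ, ih, Finset.sum_range_succ, mulLogStep]
      push_cast
      ring_nf
  have h := key (n + 1)
  rw [Finset.sum_range_succ'] at h
  push_cast at h
  rw [add_zero] at h
  rw [BohrMollerup.logGammaSeq]
  linarith

lemma concaveOn_logGammaSeq_add_half_sub (n : ℕ) :
    ConcaveOn ℝ (Ici 0) fun u =>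
      BohrMollerup.logGammaSeq (u + 1 / 2) n - u * log u - mulLogStep u := by
  simp only [logGammaSeq_add_half_sub_mul_log]
  have hsum : ∀ k : ℕ,
      ConcaveOn ℝ (Ici 0) fun u : ℝ => ∑ m ∈ Finset.range k, mulLogStep (u + (m + 1)) := by
    intro k
    induction k with
    | zero => simpa using concaveOn_const (0 : ℝ) (convex_Ici (0 : ℝ))
    | succ k ih =>
      simp only [Finset.sum_range_succ]
      exact ih.add (concaveOn_mulLogStep_add (by positivity))
  have hlog : ConcaveOn ℝ (Ici 0) fun u : ℝ => -((u + (n + 1)) * log (u + (n + 1))) :=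
    (convexOn_mul_log.neg.translate_left ((n : ℝ) + 1)).subset
      (fun u (hu : 0 ≤ u) => mem_preimage.2 (mem_Ici.2 (by positivity))) (convex_Ici 0)
  have hlin : ConcaveOn ℝ (Ici 0) fun u : ℝ => u * log n :=
    ⟨convex_Ici 0, fun x _ y _ a b _ _ _ => by simp only [smul_eq_mul]; linarith⟩
  exact (hsum n).add (hlog.add (hlin.add_const _))

/-- `u ↦ log (Γ(u + 1/2) / u ^ u)` is strictly concave on `[0, ∞)`. -/
theorem strictConcaveOn_log_Gamma_add_half_sub_mul_log :
    StrictConcaveOn ℝ (Ici 0) fun u => log (Gamma (u + 1 / 2)) - u * log u := by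
  have h : ConcaveOn ℝ (Ici 0) fun u =>
      log (Gamma (u + 1 / 2)) - u * log u - mulLogStep u := by
    refine concaveOn_of_tendsto (l := atTop) concaveOn_logGammaSeq_add_half_sub
      (convex_Ici 0) fun u hu => ?_
    have hu' : (0 : ℝ) ≤ u := hu
    exact ((BohrMollerup.tendsto_log_gamma (by positivity)).sub_const _).sub_const _
  exact (h.add_strictConcaveOn strictConcaveOn_mulLogStep).congr fun u _ => sub_add_cancel _ _

lemma StrictConcaveOn.map_add_add_map_zero_lt {g : ℝ → ℝ} (hg : StrictConcaveOn ℝ (Ici 0) g)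
    {u v : ℝ} (hu : 0 < u) (hv : 0 < v) : g (u + v) + g 0 < g u + g v := by
  have huv : 0 < u + v := by positivity
  have h : ∀ {a b : ℝ}, 0 < a → 0 < b → a + b = u + v →
      b / (u + v) * g 0 + a / (u + v) * g (u + v) < g a := by
    intro a b ha hb hab
    have := hg.2 (mem_Ici.2 le_rfl) (mem_Ici.2 huv.le) huv.ne
      (div_pos hb huv) (div_pos ha huv) (by rw [← hab]; field_simp; ring)
    simpa [div_mul_cancel₀ _ huv.ne'] using this
  have hsum : u / (u + v) + v / (u + v) = 1 := by field_simp
  linear_combination h hu hv rfl + h hv hu (add_comm v u) - (g 0 + g (u + v)) * hsum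

/-- A strict bound for the Beta-type quotient `Γ(u + v + 1/2) / (Γ(u + 1/2) Γ(v + 1/2))`. -/
theorem sqrt_pi_mul_Gamma_mul_rpow_lt {u v : ℝ} (hu : 0 < u) (hv : 0 < v) :
    √π * Gamma (u + v + 1 / 2) * (u / (u + v)) ^ u * (v / (u + v)) ^ v <
      Gamma (u + 1 / 2) * Gamma (v + 1 / 2) := by
  have huv : 0 < u + v := by positivity
  have hΓ : ∀ {t : ℝ}, 0 < t → 0 < Gamma (t + 1 / 2) := fun ht => Gamma_pos_of_pos (by positivity)
  have hΓu := hΓ hu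
  have hΓv := hΓ hv
  have hΓuv := hΓ huv
  have hπ : 0 < √π := sqrt_pos.2 pi_pos
  have hpu : 0 < (u / (u + v)) ^ u := by positivity
  have hpv : 0 < (v / (u + v)) ^ v := by positivity
  have key := strictConcaveOn_log_Gamma_add_half_sub_mul_log.map_add_add_map_zero_lt hu hv
  rw [zero_add, Gamma_one_half_eq, zero_mul] at key
  rw [← log_lt_log_iff (by positivity) (by positivity), log_mul (by positivity) hpv.ne',
    log_mul (by positivity) hpu.ne', log_mul hπ.ne' hΓuv.ne', log_mul hΓu.ne' hΓv.ne',
    log_rpow (by positivity), log_rpow (by positivity), log_div hu.ne' huv.ne',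
    log_div hv.ne' huv.ne']
  linarith


/-- With `S(d) = 2π^{(d+1)/2}/Γ((d+1)/2)` (area of the unit `d`-sphere) and
`f(x) = S(x)·S(n-x)·(x/n)^{x/2}·((n-x)/n)^{(n-x)/2}` (the Clifford area
function), one has `f(x) < 2·S(n)` on `(0,n)`; in particular twice the area of
`S^n` strictly exceeds the area of any minimal Clifford hypersurface. -/
theorem clifford_area_lt_twice_sphere (n : ℕ) (hn : 2 ≤ n) (S f : ℝ → ℝ)
    (hS : ∀ d : ℝ, 0 ≤ d → S d = 2 * Real.pi ^ ((d + 1) / 2)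
      / Real.Gamma ((d + 1) / 2))
    (hf : ∀ x ∈ Set.Ioo (0 : ℝ) n, f x =
      S x * S ((n : ℝ) - x) * (x / n) ^ (x / 2)
        * (((n : ℝ) - x) / n) ^ (((n : ℝ) - x) / 2)) :
    (∀ x ∈ Set.Ioo (0 : ℝ) n, f x < 2 * S n) ∧
    (∀ p : ℕ, 1 ≤ p → p ≤ n - 1 → f p < 2 * S n) := by
  have main : ∀ x ∈ Set.Ioo (0 : ℝ) n, f x < 2 * S n := by
    intro x hx
    obtain ⟨hx₀, hxn⟩ := hx
    have hy₀ : 0 < (n : ℝ) - x := sub_pos.2 hxn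
    have hn₀ : (0 : ℝ) < n := hx₀.trans hxn
    have key := sqrt_pi_mul_Gamma_mul_rpow_lt (half_pos hx₀) (half_pos hy₀)
    rw [show x / 2 + ((n : ℝ) - x) / 2 = n / 2 by ring, div_div_div_cancel_right₀ two_ne_zero,
      div_div_div_cancel_right₀ two_ne_zero, ← add_div, ← add_div, ← add_div] at key
    rw [hf x ⟨hx₀, hxn⟩, hS x hx₀.le, hS _ hy₀.le, hS _ hn₀.le]
    have hπ : π ^ ((x + 1) / 2) * π ^ (((n : ℝ) - x + 1) / 2) = π ^ (((n : ℝ) + 1) / 2) * √π := by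
      rw [sqrt_eq_rpow, ← rpow_add pi_pos, ← rpow_add pi_pos]
      ring_nf
    have hΓx : 0 < Gamma ((x + 1) / 2) := Gamma_pos_of_pos (by positivity)
    have hΓy : 0 < Gamma (((n : ℝ) - x + 1) / 2) := Gamma_pos_of_pos (by positivity)
    have hΓn : 0 < Gamma (((n : ℝ) + 1) / 2) := Gamma_pos_of_pos (by positivity)
    have hπn : 0 < π ^ (((n : ℝ) + 1) / 2) := rpow_pos_of_pos pi_pos _
    calc
      _ = 4 * (π ^ ((x + 1) / 2) * π ^ (((n : ℝ) - x + 1) / 2)) * (x / n) ^ (x / 2)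
            * (((n : ℝ) - x) / n) ^ (((n : ℝ) - x) / 2)
            / (Gamma ((x + 1) / 2) * Gamma (((n : ℝ) - x + 1) / 2)) := by
        field_simp
        ring
      _ < 2 * (2 * π ^ (((n : ℝ) + 1) / 2) / Gamma (((n : ℝ) + 1) / 2)) := by
        rw [hπ, ← mul_div_assoc, div_lt_div_iff₀ (by positivity) hΓn]
        linear_combination 4 * π ^ (((n : ℝ) + 1) / 2) * key
  refine ⟨main, fun p hp hpn => main p ⟨?_, ?_⟩⟩
  · exact_mod_cast hp
  · exact_mod_cast (by omega : p < n)
end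

section
/- Let n ≥ 2 be an integer. Define S(d) = 2π^{(d+1)/2}/Γ((d+1)/2) for real d ≥ 0, and f(x) = S(x)·S(n−x)·(x/n)^{x/2}·((n−x)/n)^{(n−x)/2} for x ∈ (0,n), where powers are real powers and Γ is the real Gamma function. Then for every integer p with 1 ≤ p ≤ n−1, f(p) ≥ f(⌊n/2⌋), with equality if and only if p = ⌊n/2⌋ or p = ⌈n/2⌉. In particular, among the minimal Clifford hypersurfaces C_{p,n−p} = S^{p}(√(p/n)) × S^{n−p}(√((n−p)/n)) in S^{n+1}, the hypersurface C_{⌊n/2⌋,⌈n/2⌉} has the least area. -/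
open Real in
/-- The excess of `log y + 2 log Γ(y)` over `2 log Γ(y + 1/2)`. -/
noncomputable def logGammaGap (y : ℝ) : ℝ :=
  log y + 2 * log (Gamma y) - 2 * log (Gamma (y + 1 / 2))

theorem log_Gamma_add_one {y : ℝ} (hy : 0 < y) :
    Real.log (Real.Gamma (y + 1)) = Real.log y + Real.log (Real.Gamma y) := by
  rw [Real.Gamma_add_one hy.ne', Real.log_mul hy.ne' (Real.Gamma_pos_of_pos hy).ne']

theorem logGammaGap_le_inv_two_mul {y : ℝ} (hy : 0 < y) : logGammaGap y ≤ 1 / (2 * y) := by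
  have hconv := Real.convexOn_log_Gamma.2
    (Set.mem_Ioi.2 (show 0 < y + 1 / 2 by positivity))
    (Set.mem_Ioi.2 (show 0 < y + 1 / 2 + 1 by positivity))
    (show (0 : ℝ) ≤ 1 / 2 by norm_num) (show (0 : ℝ) ≤ 1 / 2 by norm_num) (by norm_num)
  simp only [smul_eq_mul, Function.comp_apply] at hconv
  rw [show 1 / 2 * (y + 1 / 2) + 1 / 2 * (y + 1 / 2 + 1) = y + 1 by ring,
    log_Gamma_add_one hy, log_Gamma_add_one (by positivity)] at hconv
  have hlog := Real.log_le_sub_one_of_pos (x := (y + 1 / 2) / y) (by positivity)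
  rw [Real.log_div (by positivity) hy.ne'] at hlog
  have hquot : (y + 1 / 2) / y - 1 = 1 / (2 * y) := by field_simp; ring
  unfold logGammaGap
  linarith

theorem logGammaGap_sub_le_add_one {y : ℝ} (hy : 0 < y) :
    logGammaGap y - 1 / (4 * y) ≤ logGammaGap (y + 1) - 1 / (4 * (y + 1)) := by
  have hlog := Real.log_le_sub_one_of_pos (x := (y + 1 / 2) ^ 2 / (y * (y + 1))) (by positivity)
  rw [Real.log_div (by positivity) (by positivity), Real.log_mul (by positivity) (by positivity),
    Real.log_pow] at hlog
  have hquot : (y + 1 / 2) ^ 2 / (y * (y + 1)) - 1 = 1 / (4 * y) - 1 / (4 * (y + 1)) := by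
    field_simp; ring
  have hhalf := log_Gamma_add_one (y := y + 1 / 2) (by positivity)
  unfold logGammaGap
  rw [show y + 1 + 1 / 2 = y + 1 / 2 + 1 by ring, hhalf, log_Gamma_add_one hy]
  push_cast at hlog
  linarith

theorem logGammaGap_le_inv_four_mul {y : ℝ} (hy : 0 < y) : logGammaGap y ≤ 1 / (4 * y) := by
  have hmono (k : ℕ) :
      logGammaGap y - 1 / (4 * y) ≤ logGammaGap (y + k) - 1 / (4 * (y + k)) := by
    induction k with
    | zero => simp
    | succ k ih =>
      have := logGammaGap_sub_le_add_one (y := y + k) (by positivity)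
      push_cast
      rw [← add_assoc]
      exact ih.trans this
  have hbound (k : ℕ) : logGammaGap y - 1 / (4 * y) ≤ 1 / ((k : ℝ) + 1) := by
    have hgap := logGammaGap_le_inv_two_mul (y := y + (k + 1 : ℕ)) (by positivity)
    have hpos : 0 < 1 / (4 * (y + (k + 1 : ℕ))) := by positivity
    have hle : 1 / (2 * (y + (k + 1 : ℕ))) ≤ 1 / ((k : ℝ) + 1) := by
      push_cast
      gcongr
      linarith [(Nat.cast_nonneg k : (0 : ℝ) ≤ k)]
    linarith [hmono (k + 1)]
  linarith [ge_of_tendsto' tendsto_one_div_add_atTop_nhds_zero_nat hbound]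

theorem sq_lt_one_add_mul_log_add_one_sub_mul_log {u : ℝ} (hu : 0 < u) (hu' : u < 1) :
    u ^ 2 < (1 + u) * Real.log (1 + u) + (1 - u) * Real.log (1 - u) := by
  let F : ℝ → ℝ := fun t =>
    (1 + t) * Real.log (1 + t) + (1 - t) * Real.log (1 - t) - t ^ 2
  have hderiv (t : ℝ) (ht : 0 ≤ t) (ht' : t < 1) :
      HasDerivAt F (Real.log (1 + t) - Real.log (1 - t) - 2 * t) t := by
    have hadd : HasDerivAt (fun s : ℝ => 1 + s) 1 t := (hasDerivAt_id t).const_add 1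
    have hsub : HasDerivAt (fun s : ℝ => 1 - s) (-1) t := (hasDerivAt_id t).const_sub 1
    have h := (((Real.hasDerivAt_mul_log (x := 1 + t) (by linarith)).comp t hadd).add
      ((Real.hasDerivAt_mul_log (x := 1 - t) (by linarith)).comp t hsub)).sub
      (hasDerivAt_pow 2 t)
    refine h.congr_deriv ?_
    push_cast
    ring
  have hmono : StrictMonoOn F (Set.Icc 0 u) := by
    refine strictMonoOn_of_deriv_pos (convex_Icc 0 u)
      (fun t ht => (hderiv t ht.1 (ht.2.trans_lt hu')).continuousAt.continuousWithinAt) ?_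
    intro t ht
    rw [interior_Icc] at ht
    have ht1 : t < 1 := ht.2.trans hu'
    have ht0 : 0 < t := ht.1
    rw [(hderiv t ht0.le ht1).deriv]
    have h := Real.sum_range_le_log_div ht0.le ht1 2
    rw [Real.log_div (by linarith) (by linarith)] at h
    norm_num [Finset.sum_range_succ] at h
    have : 0 < t ^ 3 := by positivity
    linarith
  have h := hmono (Set.left_mem_Icc.2 hu.le) (Set.right_mem_Icc.2 hu.le) hu
  simp only [F] at h
  norm_num at h
  linarith

theorem inv_lt_second_difference_mul_log {m : ℝ} (hm : 1 < m) :
    1 / m < (m + 1) * Real.log (m + 1) + (m - 1) * Real.log (m - 1) - 2 * m * Real.log m := by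
  have hm0 : 0 < m := by linarith
  have h := sq_lt_one_add_mul_log_add_one_sub_mul_log (u := 1 / m) (by positivity)
    ((div_lt_one hm0).2 hm)
  rw [show 1 + 1 / m = (m + 1) / m by field_simp, show 1 - 1 / m = (m - 1) / m by field_simp,
    Real.log_div (by linarith) hm0.ne', Real.log_div (by linarith) hm0.ne'] at h
  have h' := mul_lt_mul_of_pos_left h hm0
  have hl : m * (1 / m) ^ 2 = 1 / m := by field_simp
  have hr : m * ((m + 1) / m * (Real.log (m + 1) - Real.log m) +
      (m - 1) / m * (Real.log (m - 1) - Real.log m)) =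
      (m + 1) * Real.log (m + 1) + (m - 1) * Real.log (m - 1) - 2 * m * Real.log m := by
    field_simp; ring
  rwa [hl, hr] at h'

open Real in
/-- The contribution of one spherical factor of dimension `x` to the logarithm of the area of a
Clifford hypersurface, up to terms affine in `x`. -/
noncomputable def cliffordLogFactor (x : ℝ) : ℝ :=
  x / 2 * log x - log (Gamma ((x + 1) / 2))

theorem cliffordLogFactor_second_difference_pos {x : ℝ} (hx : 0 < x) :
    2 * cliffordLogFactor (x + 1) < cliffordLogFactor x + cliffordLogFactor (x + 2) := by
  have hlog := inv_lt_second_difference_mul_log (m := x + 1) (by linarith)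
  have hgap := logGammaGap_le_inv_four_mul (y := (x + 1) / 2) (by positivity)
  have hΓ := log_Gamma_add_one (y := (x + 1) / 2) (by positivity)
  have hquot : 1 / (4 * ((x + 1) / 2)) = 1 / 2 * (1 / (x + 1)) := by field_simp; norm_num
  rw [hquot] at hgap
  unfold logGammaGap at hgap
  unfold cliffordLogFactor
  rw [show (x + 2 + 1) / 2 = (x + 1) / 2 + 1 by ring, hΓ,
    show (x + 1 + 1) / 2 = (x + 1) / 2 + 1 / 2 by ring]
  rw [show x + 1 + 1 = x + 2 by ring, show x + 1 - 1 = x by ring] at hlog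
  linarith

theorem cliffordLogFactor_difference_strictMono :
    StrictMono fun j : ℕ =>
      cliffordLogFactor ((j + 2 : ℕ) : ℝ) - cliffordLogFactor ((j + 1 : ℕ) : ℝ) := by
  refine strictMono_nat_of_lt_succ fun j => ?_
  have h := cliffordLogFactor_second_difference_pos (x := (j + 1 : ℕ)) (by positivity)
  rw [show ((j + 1 : ℕ) : ℝ) + 1 = (j + 2 : ℕ) by push_cast; ring,
    show ((j + 1 : ℕ) : ℝ) + 2 = (j + 3 : ℕ) by push_cast; ring] at h
  change _ < cliffordLogFactor ((j + 3 : ℕ) : ℝ) - cliffordLogFactor ((j + 2 : ℕ) : ℝ)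
  linarith

/-- Spreading two dimensions apart, with fixed sum, increases the logarithmic area. -/
theorem cliffordLogFactor_add_lt_of_spread {a b : ℕ} (hab : a ≤ b) {p q : ℕ} (hp : 1 ≤ p)
    (hpa : p < a) (hsum : p + q = a + b) :
    cliffordLogFactor a + cliffordLogFactor b < cliffordLogFactor p + cliffordLogFactor q := by
  have hstep (i j : ℕ) (hi : 1 ≤ i) (hij : i ≤ j) :
      cliffordLogFactor (i + 1 : ℕ) + cliffordLogFactor (j + 1 : ℕ) <
        cliffordLogFactor i + cliffordLogFactor (j + 2 : ℕ) := by
    obtain ⟨i, rfl⟩ := Nat.exists_eq_add_of_le' hi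
    have h := cliffordLogFactor_difference_strictMono (show i < j by omega)
    simp only at h
    linarith
  obtain ⟨k, rfl⟩ := Nat.exists_eq_add_of_lt hpa
  induction k generalizing p q with
  | zero =>
    obtain ⟨j, rfl⟩ := Nat.exists_eq_add_of_le' (show 1 ≤ b by omega)
    obtain rfl : q = j + 2 := by omega
    exact hstep p j hp (by omega)
  | succ k ih =>
    obtain ⟨j, rfl⟩ := Nat.exists_eq_add_of_le' (show 2 ≤ q by omega)
    have h := hstep p j hp (by omega)
    have h' := ih (p := p + 1) (q := j + 1) (by omega) (by omega) (by omega) (by omega)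
    rw [show p + 1 + k + 1 = p + (k + 1) + 1 by omega] at h'
    exact h'.trans h


/-- With `S(d) = 2π^{(d+1)/2}/Γ((d+1)/2)` and the Clifford area function
`f(x) = S(x)·S(n-x)·(x/n)^{x/2}·((n-x)/n)^{(n-x)/2}` on `(0,n)`, for every
integer `1 ≤ p ≤ n-1` one has `f(p) ≥ f(⌊n/2⌋)`, with equality iff
`p = ⌊n/2⌋` or `p = ⌈n/2⌉`: the balanced minimal Clifford hypersurface has
least area. -/
theorem clifford_area_min_at_half (n : ℕ) (hn : 2 ≤ n) (S f : ℝ → ℝ)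
    (hS : ∀ d : ℝ, 0 ≤ d → S d = 2 * Real.pi ^ ((d + 1) / 2)
      / Real.Gamma ((d + 1) / 2))
    (hf : ∀ x ∈ Set.Ioo (0 : ℝ) n, f x =
      S x * S ((n : ℝ) - x) * (x / n) ^ (x / 2)
        * (((n : ℝ) - x) / n) ^ (((n : ℝ) - x) / 2)) :
    ∀ p : ℕ, 1 ≤ p → p ≤ n - 1 →
      f ((n / 2 : ℕ) : ℝ) ≤ f (p : ℝ) ∧
      (f (p : ℝ) = f ((n / 2 : ℕ) : ℝ) ↔ p = n / 2 ∨ p = (n + 1) / 2) := by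
  let L : ℕ → ℝ := fun p => cliffordLogFactor p + cliffordLogFactor ((n - p : ℕ) : ℝ)
  obtain ⟨C, hC⟩ : ∃ C : ℝ, ∀ p : ℕ, 1 ≤ p → p ≤ n - 1 → f p = Real.exp (C + L p) := by
    refine ⟨2 * Real.log 2 + (n + 2) / 2 * Real.log Real.pi - n / 2 * Real.log n,
      fun p hp hpn => ?_⟩
    have hp0 : (0 : ℝ) < p := by exact_mod_cast hp
    have hlt : p < n := by omega
    have hpn' : (p : ℝ) < n := by exact_mod_cast hlt
    have hq0 : (0 : ℝ) < n - p := by linarith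
    have hn0 : (0 : ℝ) < n := by linarith
    have hlogS (d : ℝ) (hd : 0 < d) : S d = Real.exp
        (Real.log 2 + (d + 1) / 2 * Real.log Real.pi - Real.log (Real.Gamma ((d + 1) / 2))) := by
      have hΓ := Real.Gamma_pos_of_pos (show 0 < (d + 1) / 2 by linarith)
      rw [hS d hd.le, Real.exp_sub, Real.exp_add, Real.exp_log two_pos, Real.exp_log hΓ,
        Real.rpow_def_of_pos Real.pi_pos, mul_comm (Real.log Real.pi)]
    rw [hf p ⟨hp0, hpn'⟩, hlogS _ hp0, hlogS _ hq0, Real.rpow_def_of_pos (by positivity),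
      Real.rpow_def_of_pos (by positivity), Real.log_div hp0.ne' hn0.ne',
      Real.log_div hq0.ne' hn0.ne', ← Real.exp_add, ← Real.exp_add, ← Real.exp_add]
    simp only [L, cliffordLogFactor, Nat.cast_sub hlt.le]
    congr 1
    ring
  have hsymm (p : ℕ) (hp : p ≤ n) : L (n - p) = L p := by
    simp only [L, Nat.sub_sub_self hp]
    exact add_comm _ _
  have hlt (p : ℕ) (hp : 1 ≤ p) (hpn : p < n / 2) : L (n / 2) < L p :=
    cliffordLogFactor_add_lt_of_spread (by omega) hp hpn (by omega)
  intro p hp hpn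
  rw [hC p hp hpn, hC (n / 2) (by omega) (by omega), Real.exp_le_exp, Real.exp_eq_exp,
    add_le_add_iff_left, add_right_inj]
  by_cases hmid : p = n / 2 ∨ p = (n + 1) / 2
  · have heq : L p = L (n / 2) := by
      rcases hmid with rfl | h
      · rfl
      · rw [← hsymm p (by omega), show n - p = n / 2 by omega]
    exact ⟨heq.ge, iff_of_true heq hmid⟩
  · have h : L (n / 2) < L p := by
      rcases lt_or_ge p (n / 2) with h | h
      · exact hlt p hp h
      · rw [← hsymm p (by omega)]
        exact hlt (n - p) (by omega) (by omega)
    exact ⟨h.le, iff_of_false h.ne' hmid⟩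
end
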